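/- For a function r : [0,∞) → X, the following are equivalent: (i) for every τ > 0 there is a finite sequence 0 = s_0 < s_1 < … < s_n = τ such that r is constant on each open interval (s_i, s_{i+1}); (ii) the set S = { t ∈ [0,∞) : for every ε > 0 there exists α ∈ [0,∞) with |α − t| < ε and r(α) ≠ r(t) } of significant moments of r is discrete, that is, S has finite intersection with every bounded interval. -/

import Mathlib

namespace RailCross

/-- `f` is piecewise constant on `[0, ∞)`: for every `τ > 0` there is a finite
partition `0 = s 0 < s 1 < … < s n = τ` such that `f` is constant on each open
subinterval `(s i, s (i+1))`. -/
def PWC {Y : Type*} (f : ℝ → Y) : Prop :=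
  ∀ τ : ℝ, 0 < τ → ∃ n : ℕ, ∃ s : ℕ → ℝ,
    s 0 = 0 ∧ s n = τ ∧ (∀ i < n, s i < s (i + 1)) ∧
    (∀ i < n, ∀ a b : ℝ, s i < a → a < b → b < s (i + 1) → f a = f b)

/-- The significant moments of `r`. -/
def significantMoments {X : Type*} (r : ℝ → X) : Set ℝ :=
  {t : ℝ | 0 ≤ t ∧ ∀ ε : ℝ, 0 < ε → ∃ α : ℝ, 0 ≤ α ∧ |α - t| < ε ∧ r α ≠ r t}

/-- Every point between the first and the last term of a sequence is a term of the sequence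
or lies strictly between two consecutive terms. -/
theorem exists_eq_or_mem_Ioo {s : ℕ → ℝ} {t : ℝ} (n : ℕ) (h0 : s 0 ≤ t) (hn : t ≤ s n) :
    (∃ i ≤ n, s i = t) ∨ ∃ i < n, t ∈ Set.Ioo (s i) (s (i + 1)) := by
  induction n with
  | zero => exact Or.inl ⟨0, le_rfl, le_antisymm h0 hn⟩
  | succ n ih =>
    rcases le_or_gt t (s n) with h | h
    · rcases ih h with ⟨i, hi, e⟩ | ⟨i, hi, e⟩
      · exact Or.inl ⟨i, by omega, e⟩
      · exact Or.inr ⟨i, by omega, e⟩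
    · rcases hn.eq_or_lt with e | hgt
      · exact Or.inl ⟨n + 1, le_rfl, e.symm⟩
      · exact Or.inr ⟨n, by omega, h, hgt⟩

/-- A function is constant on an open interval without significant moments. -/
theorem eq_of_disjoint_significantMoments {X : Type*} {r : ℝ → X} {c d : ℝ} (hc : 0 ≤ c)
    (h : ∀ t ∈ Set.Ioo c d, t ∉ significantMoments r) {a b : ℝ}
    (ha : a ∈ Set.Ioo c d) (hb : b ∈ Set.Ioo c d) : r a = r b := by
  let _ : TopologicalSpace X := ⊥
  have : DiscreteTopology X := ⟨rfl⟩
  refine isPreconnected_Ioo.constant (fun t ht => ?_) ha hb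
  have h_not := h t ht
  simp only [significantMoments, Set.mem_ofPred_eq] at h_not
  push Not at h_not
  obtain ⟨ε, hε, hr⟩ := h_not (hc.trans ht.1.le)
  refine ContinuousAt.continuousWithinAt ((continuousAt_const (y := r t)).congr ?_)
  filter_upwards [lt_mem_nhds ht.1, Metric.ball_mem_nhds t hε] with α hα hball
  exact (hr α (hc.trans hα.le) (by rwa [Metric.mem_ball, Real.dist_eq] at hball)).symm

/-- An interval `[0, τ]` whose interior contains finitely many significant moments admits a
finite partition into intervals on whose interiors `r` is constant. -/
theorem exists_partition_of_finite {X : Type*} {r : ℝ → X} (k : ℕ) :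
    ∀ τ : ℝ, 0 < τ → (significantMoments r ∩ Set.Ioo 0 τ).Finite →
      (significantMoments r ∩ Set.Ioo 0 τ).ncard = k →
      ∃ n : ℕ, ∃ s : ℕ → ℝ,
        s 0 = 0 ∧ s n = τ ∧ (∀ i < n, s i < s (i + 1)) ∧
        (∀ i < n, ∀ a b : ℝ, s i < a → a < b → b < s (i + 1) → r a = r b) := by
  induction k using Nat.strong_induction_on with
  | _ k ih =>
    intro τ hτ hfin hk
    rcases (significantMoments r ∩ Set.Ioo 0 τ).eq_empty_or_nonempty with he | hne
    · refine ⟨1, fun i => if i = 0 then 0 else τ, by simp, by simp, ?_, ?_⟩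
      · intro i hi
        obtain rfl : i = 0 := by omega
        simpa using hτ
      · intro i hi a b h1 h2 h3
        obtain rfl : i = 0 := by omega
        simp only [if_true, zero_add, one_ne_zero, if_false] at h1 h3
        exact eq_of_disjoint_significantMoments le_rfl
          (fun t ht hS => Set.eq_empty_iff_forall_notMem.1 he t ⟨hS, ht⟩)
          ⟨h1, h2.trans h3⟩ ⟨h1.trans h2, h3⟩
    · obtain ⟨m, hm, hmax⟩ := hfin.exists_maximal hne
      have hss : significantMoments r ∩ Set.Ioo 0 m ⊂ significantMoments r ∩ Set.Ioo 0 τ :=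
        ⟨fun x hx => ⟨hx.1, hx.2.1, hx.2.2.trans hm.2.2⟩, fun h => lt_irrefl _ (h hm).2.2⟩
      obtain ⟨n, s, h0, hn, hlt, hr⟩ := ih _ (hk ▸ Set.ncard_lt_ncard hss hfin) m hm.2.1
        (hfin.subset hss.subset) rfl
      refine ⟨n + 1, fun i => if i ≤ n then s i else τ, by simpa using h0, by simp, ?_, ?_⟩
      · intro i hi
        rcases (Nat.lt_succ_iff.1 hi).eq_or_lt with rfl | hlast
        · simpa [hn] using hm.2.2
        · simpa [hlast.le, Nat.succ_le_of_lt hlast] using hlt i hlast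
      · intro i hi a b h1 h2 h3
        rcases (Nat.lt_succ_iff.1 hi).eq_or_lt with rfl | hlast
        · simp only [le_refl, if_true, hn] at h1
          simp only [Nat.not_succ_le_self, if_false] at h3
          refine eq_of_disjoint_significantMoments hm.2.1.le (fun t ht hS => ?_)
            ⟨h1, h2.trans h3⟩ ⟨h1.trans h2, h3⟩
          exact absurd (hmax ⟨hS, hm.2.1.trans ht.1, ht.2⟩ ht.1.le) (not_le.2 ht.1)
        · simp only [hlast.le, Nat.succ_le_of_lt hlast, if_true] at h1 h3
          exact hr i hlast a b h1 h2 h3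

theorem discreteness_characterization {X : Type*} (r : ℝ → X) :
    PWC r ↔
      ∀ τ : ℝ,
        ({t : ℝ | 0 ≤ t ∧ ∀ ε : ℝ, 0 < ε → ∃ α : ℝ, 0 ≤ α ∧ |α - t| < ε ∧ r α ≠ r t} ∩
          Set.Icc 0 τ).Finite := by
  constructor
  · intro h τ
    obtain ⟨n, s, h0, hn, -, hr⟩ := h (|τ| + 1) (by positivity)
    refine ((Set.finite_Iic n).image s).subset ?_
    rintro t ⟨⟨ht, hsig⟩, -, htτ⟩
    rcases exists_eq_or_mem_Ioo n (h0.trans_le ht)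
      (hn ▸ htτ.trans ((le_abs_self τ).trans (by linarith))) with ⟨i, hi, e⟩ | ⟨i, hi, h1, h2⟩
    · exact ⟨i, hi, e⟩
    · obtain ⟨α, -, hα, hne⟩ := hsig (min (t - s i) (s (i + 1) - t))
        (lt_min (sub_pos.2 h1) (sub_pos.2 h2))
      obtain ⟨hα1, hα2⟩ := lt_min_iff.1 hα
      rw [abs_lt] at hα1 hα2
      rcases lt_trichotomy α t with hlt | rfl | hlt
      · exact absurd (hr i hi α t (by linarith) hlt h2) hne
      · exact absurd rfl hne
      · exact absurd (hr i hi t α h1 hlt (by linarith)).symm hne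
  · intro h τ hτ
    exact exists_partition_of_finite _ τ hτ
      ((h τ).subset (Set.inter_subset_inter_right _ Set.Ioo_subset_Icc_self)) rfl

end RailCross
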